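/- arXiv:1909.13029 — 5 statements merged into one kernel-verified Lean document; each statement's English description precedes it below -/
import Mathlib

section
/- Let G be a connected paired threshold graph and let I ⊎ U be a canonical paired threshold partition of G with p = |I|. Then there exists a clique path C₁, …, C_ℓ of G with ℓ ≥ p such that, for each 1 ≤ i ≤ p, the set C_i ∩ I consists of exactly one vertex, this vertex is simplicial in G, and C_i ∖ I ⊆ C_p. -/
/-- `G` is a paired threshold graph: there are positive vertex weights and two
positive thresholds such that distinct vertices are adjacent iff their weight
sum is at least `Tp` and their weight difference is at most `Tm`. -/
def IsPairedThresholdGraph {V : Type*} (G : SimpleGraph V) : Prop :=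
  ∃ (w : V → ℝ) (Tp Tm : ℝ), (∀ v, 0 < w v) ∧ 0 < Tp ∧ 0 < Tm ∧
    ∀ u v, u ≠ v → (G.Adj u v ↔ Tp ≤ w u + w v ∧ |w u - w v| ≤ Tm)

/-- `G` is an interval graph: vertices can be assigned nonempty closed real
intervals so that distinct vertices are adjacent iff their intervals meet. -/
def IsIntervalGraph {V : Type*} (G : SimpleGraph V) : Prop :=
  ∃ l r : V → ℝ, (∀ v, l v ≤ r v) ∧
    ∀ u v, u ≠ v →
      (G.Adj u v ↔ (Set.Icc (l u) (r u) ∩ Set.Icc (l v) (r v)).Nonempty)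

/-- `G` is a unit interval graph: vertices can be assigned closed real intervals
of length one so that distinct vertices are adjacent iff their intervals meet. -/
def IsUnitIntervalGraph {V : Type*} (G : SimpleGraph V) : Prop :=
  ∃ l : V → ℝ,
    ∀ u v, u ≠ v →
      (G.Adj u v ↔ (Set.Icc (l u) (l u + 1) ∩ Set.Icc (l v) (l v + 1)).Nonempty)

/-- `G` is a threshold graph: there are positive vertex weights and a positive
threshold such that distinct vertices are adjacent iff their weight sum is at
least `T`. -/
def IsThresholdGraph {V : Type*} (G : SimpleGraph V) : Prop :=
  ∃ (w : V → ℝ) (T : ℝ), (∀ v, 0 < w v) ∧ 0 < T ∧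
    ∀ u v, u ≠ v → (G.Adj u v ↔ T ≤ w u + w v)

/-- Closed neighborhood `N[X]` of a vertex set. -/
def closedNbhd {V : Type*} (G : SimpleGraph V) (X : Set V) : Set V :=
  X ∪ {u | ∃ x ∈ X, G.Adj x u}

/-- Open neighborhood `N(X)` of a vertex set. -/
def openNbhd {V : Type*} (G : SimpleGraph V) (X : Set V) : Set V :=
  closedNbhd G X \ X

/-- A vertex is simplicial if its closed neighborhood is a clique. -/
def IsSimplicial {V : Type*} (G : SimpleGraph V) (v : V) : Prop :=
  G.IsClique (insert v (G.neighborSet v))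

/-- A broom ordering of `G` (vertices indexed `0, …, n-1` by the bijection `σ`):
the reversal of `σ` is an interval ordering, and there is `p` such that the first
`p` vertices have all their neighbors after position `p`, occupying consecutive
positions, while the last `n - p` vertices form an umbrella ordering. -/
def IsBroomOrdering {V : Type*} [Fintype V] (G : SimpleGraph V)
    (σ : V ≃ Fin (Fintype.card V)) : Prop :=
  (∀ x y z : V, σ x < σ y → σ y < σ z → G.Adj x z → G.Adj y z) ∧
  ∃ p : ℕ, p ≤ Fintype.card V ∧
    (∀ u : V, (σ u : ℕ) < p →
      (∀ v : V, G.Adj u v → p ≤ (σ v : ℕ)) ∧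
      (∀ a b c : Fin (Fintype.card V),
        (∃ x, G.Adj u x ∧ σ x = a) → (∃ x, G.Adj u x ∧ σ x = c) →
        a ≤ b → b ≤ c → ∃ x, G.Adj u x ∧ σ x = b)) ∧
    (∀ x y z : V, p ≤ (σ x : ℕ) → σ x < σ y → σ y < σ z →
      G.Adj x z → G.Adj x y ∧ G.Adj y z)

/-- An umbrella ordering of a graph `H`. -/
def IsUmbrellaOrdering {W : Type*} (H : SimpleGraph W) (σ : W ≃ Fin (Nat.card W)) : Prop :=
  ∀ x y z : W, σ x < σ y → σ y < σ z → H.Adj x z → H.Adj x y ∧ H.Adj y z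

/-- `I ⊎ U` is a paired threshold partition of `G`. -/
def IsPairedThresholdPartition {V : Type*} (G : SimpleGraph V) (I U : Set V) : Prop :=
  I ∪ U = Set.univ ∧ Disjoint I U ∧
  (∀ x ∈ I, ∀ y ∈ I, ¬ G.Adj x y) ∧
  IsUnitIntervalGraph (G.induce U) ∧
  IsThresholdGraph (G.induce (closedNbhd G I)) ∧
  ∃ σ : ↥U ≃ Fin (Nat.card ↥U),
    IsUmbrellaOrdering (G.induce U) σ ∧
    (∀ v ∈ I, ∀ a b c : Fin (Nat.card ↥U),
      (∃ x : ↥U, G.Adj v ↑x ∧ σ x = a) → (∃ x : ↥U, G.Adj v ↑x ∧ σ x = c) →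
      a ≤ b → b ≤ c → ∃ x : ↥U, G.Adj v ↑x ∧ σ x = b) ∧
    (∀ u : ↥U, (σ u : ℕ) = 0 → openNbhd G I ⊆ insert (↑u) (G.neighborSet ↑u))

/-- A canonical paired threshold partition: `I` cannot be enlarged by moving a
vertex of `U` into it. -/
def IsCanonicalPTPartition {V : Type*} (G : SimpleGraph V) (I U : Set V) : Prop :=
  IsPairedThresholdPartition G I U ∧
  ∀ v ∈ U, ¬ IsPairedThresholdPartition G (insert v I) (U \ {v})

/-- A maximal clique of `G`. -/
def IsMaximalClique {V : Type*} (G : SimpleGraph V) (s : Set V) : Prop :=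
  G.IsClique s ∧ ∀ t : Set V, G.IsClique t → s ⊆ t → s = t

/-- A clique path of `G`: a sequence listing each maximal clique exactly once,
in which the cliques containing any fixed vertex occur consecutively. -/
def IsCliquePath {V : Type*} (G : SimpleGraph V) {ℓ : ℕ} (C : Fin ℓ → Set V) : Prop :=
  Function.Injective C ∧
  (∀ i, IsMaximalClique G (C i)) ∧
  (∀ s : Set V, IsMaximalClique G s → ∃ i, C i = s) ∧
  (∀ v : V, ∀ i j k : Fin ℓ, i ≤ j → j ≤ k → v ∈ C i → v ∈ C k → v ∈ C j)

/-- The vertex `v` together with its neighbors that come after it in the order given by `π`. -/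
def laterClosedNbhd {V : Type*} (G : SimpleGraph V) (π : V → ℕ) (v : V) : Set V :=
  {z | z = v ∨ (π v < π z ∧ G.Adj v z)}

section IntervalOrder

variable {V : Type*} {G : SimpleGraph V} {π : V → ℕ}

theorem isClique_laterClosedNbhd (hinj : Function.Injective π)
    (hint : ∀ x y z, π x < π y → π y < π z → G.Adj x z → G.Adj y z) (v : V) :
    G.IsClique (laterClosedNbhd G π v) := by
  rintro a ha b hb hab
  rcases ha with rfl | ⟨ha, hva⟩ <;> rcases hb with rfl | ⟨hb, hvb⟩
  · exact absurd rfl hab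
  · exact hvb
  · exact hva.symm
  · rcases lt_trichotomy (π a) (π b) with h | h | h
    · exact hint v a b ha h hvb
    · exact absurd (hinj h) hab
    · exact (hint v b a hb h hva).symm

theorem IsMaximalClique.exists_eq_laterClosedNbhd [Finite V] [Nonempty V]
    (hinj : Function.Injective π)
    (hint : ∀ x y z, π x < π y → π y < π z → G.Adj x z → G.Adj y z) {s : Set V}
    (hs : IsMaximalClique G s) : ∃ v, laterClosedNbhd G π v = s := by
  have hne : s.Nonempty := by
    by_contra h
    rw [Set.not_nonempty_iff_eq_empty] at h
    obtain ⟨v⟩ := ‹Nonempty V›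
    have := hs.2 {v} (by simp) (by simp [h])
    simp [h] at this
  obtain ⟨v, hv, hmin⟩ := Set.exists_min_image s π s.toFinite hne
  refine ⟨v, (hs.2 _ (isClique_laterClosedNbhd hinj hint v) ?_).symm⟩
  intro z hz
  by_cases hzv : z = v
  · exact Or.inl hzv
  · exact Or.inr ⟨lt_of_le_of_ne (hmin z hz) fun h => hzv (hinj h).symm,
      hs.1 hv hz (Ne.symm hzv)⟩

theorem laterClosedNbhd_inter_subset
    (hinj : Function.Injective π)
    (hint : ∀ x y z, π x < π y → π y < π z → G.Adj x z → G.Adj y z) {a b c : V}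
    (hab : π a ≤ π b) (hbc : π b ≤ π c) :
    laterClosedNbhd G π a ∩ laterClosedNbhd G π c ⊆ laterClosedNbhd G π b := by
  rintro z ⟨hza, hzc⟩
  rcases hab.eq_or_lt with h | h
  · rwa [← hinj h]
  have hcz : π c ≤ π z := by
    rcases hzc with rfl | ⟨h', -⟩
    exacts [le_rfl, h'.le]
  rcases (hbc.trans hcz).eq_or_lt with h' | h'
  · exact Or.inl (hinj h').symm
  · rcases hza with rfl | ⟨-, hadj⟩
    · omega
    · exact Or.inr ⟨h', hint a b z h h' hadj⟩

/-- An injective vertex numbering satisfying the interval-order condition yields a clique path,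
listed by increasing least vertex. If `0, …, p - 1` all number vertices whose later
closed neighborhoods are maximal cliques, these are the first `p` cliques. -/
theorem exists_isCliquePath_of_intervalOrder [Finite V] [Nonempty V]
    (hinj : Function.Injective π)
    (hint : ∀ x y z, π x < π y → π y < π z → G.Adj x z → G.Adj y z) (p : ℕ)
    (hp : ∀ k < p, ∃ v, π v = k ∧ IsMaximalClique G (laterClosedNbhd G π v)) :
    ∃ (ℓ : ℕ) (C : Fin ℓ → Set V), IsCliquePath G C ∧ p ≤ ℓ ∧
      ∀ i : Fin ℓ, (i : ℕ) < p → ∀ v, π v = i → C i = laterClosedNbhd G π v := by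
  classical
  cases nonempty_fintype V
  let K : Finset ℕ :=
    (Finset.univ.filter fun v => IsMaximalClique G (laterClosedNbhd G π v)).image π
  have memK (k : ℕ) : k ∈ K ↔ ∃ v, IsMaximalClique G (laterClosedNbhd G π v) ∧ π v = k := by
    simp [K]
  let e := K.orderEmbOfFin rfl
  have he (i : Fin K.card) :
      ∃ v, IsMaximalClique G (laterClosedNbhd G π v) ∧ π v = e i :=
    (memK _).1 (K.orderEmbOfFin_mem rfl i)
  choose g hgmax hgπ using he
  have hsurj (k : ℕ) (hk : k ∈ K) : ∃ i, e i = k := by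
    have : k ∈ Set.range e := by rw [Finset.range_orderEmbOfFin]; exact hk
    exact this
  have hpK : Finset.range p ⊆ K := fun k hk => by
    obtain ⟨v, hv, hmax⟩ := hp k (Finset.mem_range.1 hk)
    exact (memK k).2 ⟨v, hmax, hv⟩
  have hle : ∀ k (hk : k < K.card), k ≤ e ⟨k, hk⟩ := by
    intro k
    induction k with
    | zero => intro _; exact Nat.zero_le _
    | succ k ih =>
      intro hk
      have h1 := ih (by omega)
      have h2 : e ⟨k, by omega⟩ < e ⟨k + 1, hk⟩ := e.strictMono (by simp [Fin.lt_def])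
      omega
  have hfix : ∀ k (hk : k < K.card), k < p → e ⟨k, hk⟩ = k := by
    intro k
    induction k using Nat.strong_induction_on with
    | _ k ih =>
      intro hk hkp
      obtain ⟨⟨j, hj⟩, hjk⟩ := hsurj k (hpK (Finset.mem_range.2 hkp))
      have hjle := hle j hj
      rcases (show j ≤ k by omega).eq_or_lt with rfl | h
      · exact hjk
      · have := ih j h hj (by omega)
        omega
  refine ⟨K.card, fun i => laterClosedNbhd G π (g i), ⟨?_, hgmax, ?_, ?_⟩, ?_, ?_⟩
  · intro i j hij
    have hmin (a b : V) (h : laterClosedNbhd G π a = laterClosedNbhd G π b) : π b ≤ π a := by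
      have : a ∈ laterClosedNbhd G π b := h ▸ Or.inl rfl
      rcases this with rfl | ⟨h', -⟩
      exacts [le_rfl, h'.le]
    apply e.injective
    rw [← hgπ, ← hgπ]
    exact le_antisymm (hmin _ _ hij.symm) (hmin _ _ hij)
  · intro s hs
    obtain ⟨v, rfl⟩ := hs.exists_eq_laterClosedNbhd hinj hint
    obtain ⟨i, hi⟩ := hsurj (π v) ((memK _).2 ⟨v, hs, rfl⟩)
    exact ⟨i, congrArg _ (hinj ((hgπ i).trans hi))⟩
  · intro v i j k hij hjk hi hk
    refine laterClosedNbhd_inter_subset hinj hint ?_ ?_ ⟨hi, hk⟩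
    · rw [hgπ, hgπ]; exact e.monotone hij
    · rw [hgπ, hgπ]; exact e.monotone hjk
  · simpa using Finset.card_le_card hpK
  · intro i hi v hv
    exact congrArg _ (hinj (by rw [hgπ, hv]; exact hfix i i.2 hi))

end IntervalOrder

/-- In a paired threshold partition, the neighborhoods of the vertices of `I` are nested along
some weight function. -/
theorem IsPairedThresholdPartition.exists_weight {V : Type*} {G : SimpleGraph V} {I U : Set V}
    (h : IsPairedThresholdPartition G I U) :
    ∃ w : V → ℝ, ∀ x ∈ I, ∀ y ∈ I, w x ≤ w y → ∀ z, G.Adj x z → G.Adj y z := by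
  classical
  obtain ⟨-, -, hind, -, ⟨w, T, -, -, hw⟩, -⟩ := h
  refine ⟨fun v => if hv : v ∈ closedNbhd G I then w ⟨v, hv⟩ else 0, ?_⟩
  intro x hx y hy hxy z hz
  have hx' : x ∈ closedNbhd G I := Or.inl hx
  have hy' : y ∈ closedNbhd G I := Or.inl hy
  have hz' : z ∈ closedNbhd G I := Or.inr ⟨x, hx, hz⟩
  simp only [hx', hy', dif_pos] at hxy
  have hyz : y ≠ z := by
    rintro rfl
    exact hind x hx y hy hz
  have h1 := (hw ⟨x, hx'⟩ ⟨z, hz'⟩ (by simpa using hz.ne)).1 hz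
  exact (hw ⟨y, hy'⟩ ⟨z, hz'⟩ (by simpa using hyz)).2 (by linarith)

/-- A paired threshold partition induces an interval order of the vertices in which
`I` comes first. -/
theorem IsPairedThresholdPartition.exists_intervalOrder {V : Type*} [Finite V]
    {G : SimpleGraph V} {I U : Set V} (h : IsPairedThresholdPartition G I U) :
    ∃ π : V → ℕ, Function.Injective π ∧ (∀ v ∈ I, π v < I.ncard) ∧
      (∀ k < I.ncard, ∃ v ∈ I, π v = k) ∧ (∀ v ∉ I, I.ncard ≤ π v) ∧
      ∀ x y z, π x < π y → π y < π z → G.Adj x z → G.Adj y z := by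
  classical
  obtain ⟨w, hw⟩ := h.exists_weight
  obtain ⟨hcover, -, hind, -, -, σ, humb, -, hfirst⟩ := h
  have hU {v : V} (hv : v ∉ I) : v ∈ U :=
    (hcover.symm ▸ Set.mem_univ v : v ∈ I ∪ U).resolve_left hv
  let q : I ≃ Fin I.ncard := Finite.equivFin I
  let τ := Tuple.sort fun i => w (q.symm i)
  have hτ : Monotone ((fun i => w (q.symm i)) ∘ τ) := Tuple.monotone_sort _
  let r : I ≃ Fin I.ncard := q.trans τ.symm
  have hr (x y : I) (hxy : r x ≤ r y) : w x ≤ w y := by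
    simpa [r] using hτ hxy
  let π : V → ℕ := fun v =>
    if hv : v ∈ I then r ⟨v, hv⟩ else I.ncard + σ ⟨v, hU hv⟩
  have hπI {v : V} (hv : v ∈ I) : π v = r ⟨v, hv⟩ := dif_pos hv
  have hπU {v : V} (hv : v ∉ I) : π v = I.ncard + σ ⟨v, hU hv⟩ := dif_neg hv
  have hlt (v : V) (hv : v ∈ I) : π v < I.ncard := by
    rw [hπI hv]; exact (r ⟨v, hv⟩).2
  have hge (v : V) (hv : v ∉ I) : I.ncard ≤ π v := by
    rw [hπU hv]; omega
  have hσ {x y : V} (hx : x ∉ I) (hy : y ∉ I) (hxy : π x < π y) :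
      σ ⟨x, hU hx⟩ < σ ⟨y, hU hy⟩ := by
    rw [hπU hx, hπU hy] at hxy
    exact Fin.lt_def.2 (by omega)
  refine ⟨π, ?_, hlt, ?_, hge, ?_⟩
  · intro x y hxy
    by_cases hx : x ∈ I <;> by_cases hy : y ∈ I
    · rw [hπI hx, hπI hy] at hxy
      simpa using r.injective (Fin.ext hxy)
    · have := hlt x hx; have := hge y hy; omega
    · have := hlt y hy; have := hge x hx; omega
    · rw [hπU hx, hπU hy] at hxy
      simpa using σ.injective (Fin.ext (by omega : (σ ⟨x, hU hx⟩ : ℕ) = σ ⟨y, hU hy⟩))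
  · intro k hk
    refine ⟨r.symm ⟨k, hk⟩, (r.symm ⟨k, hk⟩).2, ?_⟩
    rw [hπI (r.symm ⟨k, hk⟩).2]
    simp
  · intro x y z hxy hyz hxz
    by_cases hy : y ∈ I
    · have hx : x ∈ I := by
        by_contra hx
        have := hlt y hy; have := hge x hx; omega
      refine hw x hx y hy (hr ⟨x, hx⟩ ⟨y, hy⟩ ?_) z hxz
      rw [hπI hx, hπI hy] at hxy
      exact Fin.le_def.2 hxy.le
    · have hz : z ∉ I := fun hz => by
        have := hlt z hz; have := hge y hy; omega
      have hyz' := hσ hy hz hyz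
      by_cases hx : x ∈ I
      · have hpos : 0 < Nat.card U := by have := (σ ⟨y, hU hy⟩).2; omega
        let u : U := σ.symm ⟨0, hpos⟩
        have hu : (σ u : ℕ) = 0 :=
          congrArg Fin.val (σ.apply_symm_apply ⟨0, hpos⟩)
        have hmem := hfirst u hu ⟨Or.inr ⟨x, hx, hxz⟩, hz⟩
        have huz : G.Adj u z := by
          rcases hmem with rfl | hadj
          · have : σ u = σ ⟨u, hU hz⟩ := rfl
            rw [← this, Fin.lt_def] at hyz'
            omega
          · exact hadj
        by_cases huy : u = ⟨y, hU hy⟩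
        · rw [huy] at huz
          exact huz
        · have hne : (σ u : ℕ) ≠ σ ⟨y, hU hy⟩ := fun h => huy (σ.injective (Fin.ext h))
          exact (humb u ⟨y, hU hy⟩ ⟨z, hU hz⟩ (Fin.lt_def.2 (by omega)) hyz' huz).2
      · exact (humb ⟨x, hU hx⟩ ⟨y, hU hy⟩ ⟨z, hU hz⟩ (hσ hx hy hxy) hyz' hxz).2

/-- A connected paired threshold graph with canonical partition
`I ⊎ U`, `p = |I|`, has a clique path whose first `p` cliques each meet `I` in
exactly one vertex, which is simplicial, and whose non-`I` part lies in the
`p`-th clique. -/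
theorem exists_clique_path_for_canonical_partition {V : Type*} [Fintype V]
    (G : SimpleGraph V) (hconn : G.Connected) (hG : IsPairedThresholdGraph G)
    (I U : Set V) (hcan : IsCanonicalPTPartition G I U) :
    ∃ (ℓ : ℕ) (C : Fin ℓ → Set V), IsCliquePath G C ∧ I.ncard ≤ ℓ ∧
      ∀ i : Fin ℓ, (i : ℕ) < I.ncard →
        (∃ x : V, C i ∩ I = {x} ∧ IsSimplicial G x) ∧
        ∃ j : Fin ℓ, (j : ℕ) + 1 = I.ncard ∧ C i \ I ⊆ C j := by
  have hpart := hcan.1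
  obtain ⟨π, hinj, hlt, hsurj, hge, hint⟩ := hpart.exists_intervalOrder
  have hind := hpart.2.2.1
  have := hconn.nonempty
  have hlater : ∀ v ∈ I, laterClosedNbhd G π v = insert v (G.neighborSet v) := by
    intro v hv
    ext z
    refine or_congr_right ⟨And.right, fun hz => ⟨?_, hz⟩⟩
    exact (hlt v hv).trans_le (hge z fun hzI => hind v hv z hzI hz)
  have hmax : ∀ v ∈ I, IsMaximalClique G (laterClosedNbhd G π v) := by
    intro v hv
    refine ⟨isClique_laterClosedNbhd hinj hint v, fun t ht hsub => hsub.antisymm ?_⟩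
    intro z hz
    rw [hlater v hv]
    by_cases hzv : z = v
    · exact Or.inl hzv
    · exact Or.inr (ht (hsub (Or.inl rfl)) hz (Ne.symm hzv))
  obtain ⟨ℓ, C, hC, hℓ, hfirst⟩ := exists_isCliquePath_of_intervalOrder hinj hint I.ncard
    fun k hk => by
      obtain ⟨v, hv, hvk⟩ := hsurj k hk
      exact ⟨v, hvk, hmax v hv⟩
  refine ⟨ℓ, C, hC, hℓ, fun i hi => ?_⟩
  obtain ⟨v, hv, hvi⟩ := hsurj i hi
  obtain ⟨v', hv', hvj⟩ := hsurj (I.ncard - 1) (by omega)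
  rw [hfirst i hi v hvi]
  refine ⟨⟨v, ?_, ?_⟩, ⟨I.ncard - 1, by omega⟩, Nat.sub_add_cancel (by omega), ?_⟩
  · ext z
    constructor
    · rintro ⟨rfl | ⟨-, hadj⟩, hz⟩
      · rfl
      · exact absurd hadj (hind v hv z hz)
    · rintro rfl
      exact ⟨Or.inl rfl, hv⟩
  · rw [IsSimplicial, ← hlater v hv]
    exact isClique_laterClosedNbhd hinj hint v
  · rw [hfirst ⟨I.ncard - 1, by omega⟩ (by simp only; omega) v' hvj]
    rintro z ⟨rfl | ⟨hvz, hadj⟩, hz⟩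
    · exact absurd hv hz
    · have hz' := hge z hz
      have hlast := hlt v' hv'
      rcases (show π v ≤ π v' by omega).eq_or_lt with h | h
      · rw [← hinj h]
        exact Or.inr ⟨hvz, hadj⟩
      · exact Or.inr ⟨by omega, hint v v' z h (by omega) hadj⟩
end

section
/- Let G be a connected paired threshold graph and let I ⊎ U be a canonical paired threshold partition of G. Then in every clique path of G, the maximal cliques disjoint from I occupy consecutive positions; moreover, for any two clique paths of G, the subsequence formed by the maximal cliques disjoint from I in one clique path is identical to, or the exact reversal of, the corresponding subsequence in the other. -/
/-- `p` numbers the vertices of `U` by `0, …, m - 1`, and this numbering satisfies the ordering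
conditions of a paired threshold partition `I ⊎ U`. -/
structure IsPTNumbering {V : Type*} (G : SimpleGraph V) (I U : Set V) (p : V → ℕ) (m : ℕ) :
    Prop where
  bijOn : Set.BijOn p U (Set.Iio m)
  umbrella : ∀ x ∈ U, ∀ y ∈ U, ∀ z ∈ U, p x < p y → p y < p z → G.Adj x z →
    G.Adj x y ∧ G.Adj y z
  consecutive : ∀ v ∈ I, ∀ x ∈ U, ∀ y ∈ U, ∀ z ∈ U, G.Adj v x → G.Adj v z →
    p x ≤ p y → p y ≤ p z → G.Adj v y
  first : ∀ u ∈ U, p u = 0 → openNbhd G I ⊆ insert u (G.neighborSet u)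

section

variable {V : Type*} {G : SimpleGraph V} {I U : Set V} {p : V → ℕ} {m : ℕ}

theorem IsPairedThresholdPartition.exists_numbering (h : IsPairedThresholdPartition G I U) :
    ∃ p m, IsPTNumbering G I U p m := by
  classical
  obtain ⟨-, -, -, -, -, σ, humb, hcons, hfirst⟩ := h
  let p : V → ℕ := fun x => if hx : x ∈ U then (σ ⟨x, hx⟩ : ℕ) else 0
  have hp : ∀ x (hx : x ∈ U), p x = (σ ⟨x, hx⟩ : ℕ) := fun x hx => dif_pos hx
  refine ⟨p, Nat.card U, ⟨?_, ?_, ?_⟩, ?_, ?_, ?_⟩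
  · intro x hx
    rw [hp x hx]
    exact (σ ⟨x, hx⟩).2
  · intro x hx y hy hxy
    rw [hp x hx, hp y hy] at hxy
    simpa using σ.injective (Fin.ext hxy)
  · intro n hn
    refine ⟨σ.symm ⟨n, hn⟩, (σ.symm ⟨n, hn⟩).2, ?_⟩
    rw [hp _ (σ.symm ⟨n, hn⟩).2]
    exact congrArg Fin.val (σ.apply_symm_apply ⟨n, hn⟩)
  · intro x hx y hy z hz hxy hyz hadj
    rw [hp x hx, hp y hy] at hxy
    rw [hp y hy, hp z hz] at hyz
    exact humb ⟨x, hx⟩ ⟨y, hy⟩ ⟨z, hz⟩ hxy hyz hadj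
  · intro v hv x hx y hy z hz hvx hvz hxy hyz
    rw [hp x hx, hp y hy] at hxy
    rw [hp y hy, hp z hz] at hyz
    obtain ⟨t, ht, hty⟩ := hcons v hv (σ ⟨x, hx⟩) (σ ⟨y, hy⟩) (σ ⟨z, hz⟩)
      ⟨⟨x, hx⟩, hvx, rfl⟩ ⟨⟨z, hz⟩, hvz, rfl⟩ hxy hyz
    rwa [σ.injective hty] at ht
  · intro u hu h0
    rw [hp u hu] at h0
    exact hfirst ⟨u, hu⟩ h0

theorem IsPTNumbering.isPairedThresholdPartition (h : IsPTNumbering G I U p m)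
    (hunion : I ∪ U = Set.univ) (hdisj : Disjoint I U) (hI : ∀ x ∈ I, ∀ y ∈ I, ¬ G.Adj x y)
    (hunit : IsUnitIntervalGraph (G.induce U))
    (hthr : IsThresholdGraph (G.induce (closedNbhd G I))) :
    IsPairedThresholdPartition G I U := by
  have hcard : Nat.card U = m := by
    rw [Nat.card_congr h.bijOn.equiv]
    simp
  subst hcard
  let f : U → Fin (Nat.card U) := fun x => ⟨p x, h.bijOn.mapsTo x.2⟩
  have hf : Function.Bijective f := by
    refine ⟨fun x y hxy => Subtype.ext (h.bijOn.injOn x.2 y.2 (congrArg Fin.val hxy)), fun n => ?_⟩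
    obtain ⟨x, hx, hxn⟩ := h.bijOn.surjOn n.2
    exact ⟨⟨x, hx⟩, Fin.ext hxn⟩
  refine ⟨hunion, hdisj, hI, hunit, hthr, Equiv.ofBijective f hf, ?_, ?_, ?_⟩
  · intro x y z hxy hyz hadj
    exact h.umbrella x x.2 y y.2 z z.2 hxy hyz hadj
  · rintro v hv _ b _ ⟨x, hvx, rfl⟩ ⟨z, hvz, rfl⟩ hab hbc
    obtain ⟨y, rfl⟩ := hf.2 b
    exact ⟨y, h.consecutive v hv x x.2 y y.2 z z.2 hvx hvz hab hbc, rfl⟩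
  · intro u hu
    exact h.first u u.2 hu

/-- The vertices numbered between two adjacent vertices form a clique. -/
theorem IsPTNumbering.adj_of_le_of_le (h : IsPTNumbering G I U p m) {a c x y : V}
    (ha : a ∈ U) (hc : c ∈ U) (hx : x ∈ U) (hy : y ∈ U) (hac : G.Adj a c)
    (hax : p a ≤ p x) (hxc : p x ≤ p c) (hay : p a ≤ p y) (hyc : p y ≤ p c) (hxy : x ≠ y) :
    G.Adj x y := by
  have hlt : ∀ x ∈ U, ∀ y ∈ U, p a ≤ p x → p y ≤ p c → p x < p y → G.Adj x y := by
    intro x hx y hy hax hyc hxy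
    have hay : G.Adj a y := by
      rcases hyc.lt_or_eq with hlt | heq
      · exact (h.umbrella a ha y hy c hc (by omega) hlt hac).1
      · rwa [h.bijOn.injOn hy hc heq]
    rcases hax.lt_or_eq with hlt | heq
    · exact (h.umbrella a ha x hx y hy hlt hxy hay).2
    · rwa [← h.bijOn.injOn ha hx heq]
  rcases lt_trichotomy (p x) (p y) with hlt' | heq | hgt
  · exact hlt x hx y hy hax hyc hlt'
  · exact absurd (h.bijOn.injOn hx hy heq) hxy
  · exact (hlt y hy x hx hay hxc hgt).symm

/-- In a connected graph, consecutively numbered vertices are adjacent. -/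
theorem IsPTNumbering.adj_succ (h : IsPTNumbering G I U p m) (hconn : G.Connected)
    (hunion : I ∪ U = Set.univ) (hdisj : Disjoint I U) (hI : ∀ x ∈ I, ∀ y ∈ I, ¬ G.Adj x y)
    {x y : V} (hx : x ∈ U) (hy : y ∈ U) (hxy : p y = p x + 1) : G.Adj x y := by
  by_contra hnadj
  have hcross : ∀ a ∈ U, ∀ b ∈ U, p a ≤ p x → G.Adj a b → p b ≤ p x := by
    intro a ha b hb hax hab
    by_contra hbx
    refine hnadj (h.adj_of_le_of_le ha hb hx hy hab hax ?_ ?_ ?_ ?_)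
    · omega
    · omega
    · omega
    · rintro rfl
      omega
  have hmem : ∀ t, t ∈ I ∨ t ∈ U := fun t => by
    have : t ∈ I ∪ U := hunion ▸ Set.mem_univ t
    exact this
  obtain ⟨u, hu, hu0⟩ := h.bijOn.surjOn (show 0 ∈ Set.Iio m from by
    have := h.bijOn.mapsTo hx
    simp only [Set.mem_Iio] at this ⊢
    omega)
  let P : V → Prop := fun z => (z ∈ U ∧ p z ≤ p x) ∨ (z ∈ I ∧ ∃ t ∈ U, p t ≤ p x ∧ G.Adj z t)
  have hstep : ∀ s t, G.Adj s t → P s → P t := by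
    rintro s t hst (⟨hsU, hsx⟩ | ⟨hsI, -⟩)
    · rcases hmem t with htI | htU
      · exact Or.inr ⟨htI, s, hsU, hsx, hst.symm⟩
      · exact Or.inl ⟨htU, hcross s hsU t htU hsx hst⟩
    · have htI : t ∉ I := fun htI => hI s hsI t htI hst
      have htU : t ∈ U := (hmem t).resolve_left htI
      refine Or.inl ⟨htU, ?_⟩
      have htN : t ∈ openNbhd G I := ⟨Or.inr ⟨s, hsI, hst⟩, htI⟩
      rcases h.first u hu hu0 htN with rfl | hut
      · omega
      · exact hcross u hu t htU (by omega) hut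
  have hreach : ∀ t, Relation.ReflTransGen G.Adj x t → P t := by
    intro t ht
    induction ht with
    | refl => exact Or.inl ⟨hx, le_rfl⟩
    | tail _ hst ih => exact hstep _ _ hst ih
  rcases hreach y ((SimpleGraph.reachable_iff_reflTransGen x y).1 (hconn.preconnected x y)) with
    ⟨-, hyx⟩ | ⟨hyI, -⟩
  · omega
  · exact Set.disjoint_left.1 hdisj hyI hy

theorem IsMaximalClique.mem_of_forall_adj {A : Set V} (hA : IsMaximalClique G A) {x : V}
    (hx : ∀ a ∈ A, x ≠ a → G.Adj x a) : x ∈ A := by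
  rw [hA.2 (insert x A) (hA.1.insert hx) (Set.subset_insert x A)]
  exact Set.mem_insert x A

theorem IsMaximalClique.nonempty [Nonempty V] {A : Set V} (hA : IsMaximalClique G A) :
    A.Nonempty := by
  by_contra hne
  rw [Set.not_nonempty_iff_eq_empty] at hne
  subst hne
  exact hA.mem_of_forall_adj (x := Classical.arbitrary V) (by simp)

theorem SimpleGraph.IsClique.exists_isMaximalClique [Finite V] {s : Set V} (hs : G.IsClique s) :
    ∃ t, IsMaximalClique G t ∧ s ⊆ t := by
  obtain ⟨t, hst, ht⟩ := (Set.toFinite {t : Set V | G.IsClique t}).exists_le_maximal hs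
  exact ⟨t, ⟨ht.prop, fun r hr htr => htr.antisymm (ht.le_of_ge hr htr)⟩, hst⟩

/-- The least number of a vertex in `A`. -/
noncomputable def leastNumber (p : V → ℕ) (A : Set V) : ℕ := sInf (p '' A)

/-- A maximal clique contained in `U` is an interval of the numbering. -/
theorem IsPTNumbering.exists_endpoints [Finite V] [Nonempty V] (h : IsPTNumbering G I U p m)
    {A : Set V} (hA : IsMaximalClique G A) (hAU : A ⊆ U) :
    ∃ a ∈ A, ∃ b ∈ A, p a = leastNumber p A ∧ (∀ x ∈ A, p a ≤ p x ∧ p x ≤ p b) ∧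
      ∀ x ∈ U, p a ≤ p x → p x ≤ p b → x ∈ A := by
  obtain ⟨a, ha, hpa⟩ := Nat.sInf_mem (hA.nonempty.image p)
  obtain ⟨b, hb, hpb⟩ := Set.exists_max_image A p (Set.toFinite A) hA.nonempty
  have hmin : ∀ x ∈ A, p a ≤ p x := fun x hx => hpa ▸ Nat.sInf_le (Set.mem_image_of_mem p hx)
  refine ⟨a, ha, b, hb, hpa, fun x hx => ⟨hmin x hx, hpb x hx⟩, fun x hx hax hxb => ?_⟩
  by_cases hab : a = b
  · subst hab
    rwa [h.bijOn.injOn hx (hAU ha) (by omega)]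
  · exact hA.mem_of_forall_adj fun y hy hxy => h.adj_of_le_of_le (hAU ha) (hAU hb) hx (hAU hy)
      (hA.1 ha hb hab) hax hxb (hmin y hy) (hpb y hy) hxy

theorem IsPTNumbering.eq_of_leastNumber_eq [Finite V] [Nonempty V] (h : IsPTNumbering G I U p m)
    {A B : Set V} (hA : IsMaximalClique G A) (hB : IsMaximalClique G B) (hAU : A ⊆ U)
    (hBU : B ⊆ U) (hAB : leastNumber p A = leastNumber p B) : A = B := by
  obtain ⟨a, ha, b, hb, hmin, hmem, hall⟩ := h.exists_endpoints hA hAU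
  obtain ⟨a', ha', b', hb', hmin', hmem', hall'⟩ := h.exists_endpoints hB hBU
  rcases le_total (p b) (p b') with hle | hle
  · refine hA.2 B hB.1 fun x hx => hall' x (hAU hx) ?_ ?_ <;> have := hmem x hx <;> omega
  · refine (hB.2 A hA.1 fun x hx => hall x (hBU hx) ?_ ?_).symm <;> have := hmem' x hx <;> omega

theorem IsCliquePath.lt_iff_lt_of_notMem {ℓ : ℕ} {C : Fin ℓ → Set V} (hC : IsCliquePath G C)
    {x : V} {i j k : Fin ℓ} (hxk : x ∉ C k) (hxi : x ∈ C i) (hxj : x ∈ C j) :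
    i < k ↔ j < k := by
  have key : ∀ i j : Fin ℓ, x ∈ C i → x ∈ C j → i < k → j < k := by
    intro i j hxi hxj hik
    by_contra hjk
    exact hxk (hC.2.2.2 x i k j hik.le (not_lt.1 hjk) hxi hxj)
  exact ⟨key i j hxi hxj, key j i hxj hxi⟩

/-- A stretch of the numbering avoiding a clique stays on one side of it in a clique path. -/
theorem IsPTNumbering.lt_iff_lt_of_avoids [Finite V] (h : IsPTNumbering G I U p m)
    (hadj : ∀ x ∈ U, ∀ y ∈ U, p y = p x + 1 → G.Adj x y)
    {ℓ : ℕ} {C : Fin ℓ → Set V} (hC : IsCliquePath G C) {i j k : Fin ℓ} {x y : V}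
    (hx : x ∈ U) (hy : y ∈ U) (hxy : p x ≤ p y) (hxi : x ∈ C i) (hyj : y ∈ C j)
    (havoid : ∀ z ∈ U, p x ≤ p z → p z ≤ p y → z ∉ C k) : i < k ↔ j < k := by
  have key : ∀ n, p x ≤ n → n ≤ p y → ∀ z ∈ U, p z = n → ∀ j', z ∈ C j' → (i < k ↔ j' < k) := by
    intro n hn
    induction n, hn using Nat.le_induction with
    | base =>
      intro _ z hz hzx j' hzj
      have hzx' := h.bijOn.injOn hz hx hzx
      subst hzx'
      exact hC.lt_iff_lt_of_notMem (havoid z hx le_rfl hxy) hxi hzj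
    | succ n hn ih =>
      intro hny z hz hzn j' hzj
      obtain ⟨t, ht, htn⟩ := h.bijOn.surjOn (show n ∈ Set.Iio m from by
        have := h.bijOn.mapsTo hz
        simp only [Set.mem_Iio] at this ⊢
        omega)
      have htz : G.Adj t z := hadj t ht z hz (by omega)
      obtain ⟨K, hK, hsub⟩ := (SimpleGraph.isClique_pair.2 fun _ => htz :
        G.IsClique {t, z}).exists_isMaximalClique
      obtain ⟨q, rfl⟩ := hC.2.2.1 K hK
      rw [ih (by omega) t ht htn q (hsub (by simp))]
      exact hC.lt_iff_lt_of_notMem (havoid z hz (by omega) (by omega)) (hsub (by simp)) hzj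
  exact key (p y) hxy le_rfl y hy rfl j hyj

/-- Among three maximal cliques contained in `U`, the one with the middle least number lies
between the other two in every clique path. -/
theorem IsPTNumbering.between [Finite V] [Nonempty V] (h : IsPTNumbering G I U p m)
    (hadj : ∀ x ∈ U, ∀ y ∈ U, p y = p x + 1 → G.Adj x y)
    {ℓ : ℕ} {C : Fin ℓ → Set V} (hC : IsCliquePath G C) {i j k : Fin ℓ}
    (hi : C i ⊆ U) (hj : C j ⊆ U) (hk : C k ⊆ U)
    (hij : leastNumber p (C i) < leastNumber p (C j))
    (hjk : leastNumber p (C j) < leastNumber p (C k)) :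
    (j < i ↔ k < i) ∧ (i < k ↔ j < k) := by
  obtain ⟨a, ha, b, hb, hmina, hmema, halla⟩ := h.exists_endpoints (hC.2.1 i) hi
  obtain ⟨c, hc, d, hd, hminc, hmemc, hallc⟩ := h.exists_endpoints (hC.2.1 j) hj
  obtain ⟨e, he, f, hf, hmine, hmeme, halle⟩ := h.exists_endpoints (hC.2.1 k) hk
  have hbd : p b < p d := by
    by_contra hle
    have heq := (hC.2.1 j).2 (C i) (hC.2.1 i).1 fun x hx => halla x (hj hx)
      (by have := hmemc x hx; omega) (by have := hmemc x hx; omega)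
    rw [heq] at hij
    exact lt_irrefl _ hij
  have hdf : p d < p f := by
    by_contra hle
    have heq := (hC.2.1 k).2 (C j) (hC.2.1 j).1 fun x hx => hallc x (hk hx)
      (by have := hmeme x hx; omega) (by have := hmeme x hx; omega)
    rw [heq] at hjk
    exact lt_irrefl _ hjk
  constructor
  · refine h.lt_iff_lt_of_avoids hadj hC (hj hd) (hk hf) hdf.le hd hf fun z _ hdz _ hzi => ?_
    have := hmema z hzi
    omega
  · refine h.lt_iff_lt_of_avoids hadj hC (hi ha) (hj hc) (by omega) ha hc fun z _ _ hzc hzk => ?_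
    have := hmeme z hzk
    omega

/-- A clique path lists the maximal cliques contained in `U` in increasing or decreasing order of
their least numbers. -/
theorem IsPTNumbering.strictMonoOn_or_strictAntiOn [Finite V] [Nonempty V]
    (h : IsPTNumbering G I U p m) (hadj : ∀ x ∈ U, ∀ y ∈ U, p y = p x + 1 → G.Adj x y)
    {ℓ : ℕ} {C : Fin ℓ → Set V} (hC : IsCliquePath G C) :
    StrictMonoOn (fun i => leastNumber p (C i)) {i | C i ⊆ U} ∨
      StrictAntiOn (fun i => leastNumber p (C i)) {i | C i ⊆ U} := by
  have hinj : Set.InjOn (fun i => leastNumber p (C i)) {i | C i ⊆ U} := fun i hi j hj hij =>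
    hC.1 (h.eq_of_leastNumber_eq (hC.2.1 i) (hC.2.1 j) hi hj hij)
  have hmid : ∀ i j k : Fin ℓ, C i ⊆ U → C j ⊆ U → C k ⊆ U → i ≤ j → j ≤ k →
      leastNumber p (C j) ∈ Set.uIcc (leastNumber p (C i)) (leastNumber p (C k)) := by
    intro i j k hi hj hk hij hjk
    rcases hij.eq_or_lt with rfl | hij
    · exact Set.left_mem_uIcc
    rcases hjk.eq_or_lt with rfl | hjk
    · exact Set.right_mem_uIcc
    have hne : leastNumber p (C i) ≠ leastNumber p (C k) := fun heq =>
      (hij.trans hjk).ne (hinj hi hk heq)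
    rw [Set.mem_uIcc]
    by_contra hcon
    rcases lt_or_gt_of_ne hne with hik | hki
    · rcases lt_or_ge (leastNumber p (C j)) (leastNumber p (C i)) with hlt | hge
      · have := h.between hadj hC hj hi hk hlt hik
        omega
      · have := h.between hadj hC hi hk hj hik (by omega)
        omega
    · rcases lt_or_ge (leastNumber p (C j)) (leastNumber p (C k)) with hlt | hge
      · have := h.between hadj hC hj hk hi hlt hki
        omega
      · have := h.between hadj hC hk hi hj hki (by omega)
        omega
  have hmono := Set.monotoneOn_or_antitoneOn_iff_uIcc (f := fun i => leastNumber p (C i))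
    (s := {i | C i ⊆ U}) |>.2 (by
      intro i hi k hk j hj hjm
      rcases Set.mem_uIcc.1 hjm with ⟨h1, h2⟩ | ⟨h1, h2⟩
      · exact hmid i j k hi hj hk h1 h2
      · rw [Set.uIcc_comm]
        exact hmid k j i hk hj hi h1 h2)
  exact hmono.imp (fun hm => hm.strictMonoOn_iff_injOn.2 hinj)
    (fun hm => hm.strictAnti_iff_injOn.2 hinj)

/-- The neighborhoods of independent vertices in a threshold graph are nested. -/
theorem nested_of_isThresholdGraph (hI : ∀ x ∈ I, ∀ y ∈ I, ¬ G.Adj x y)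
    (hthr : IsThresholdGraph (G.induce (closedNbhd G I))) {v v' : V} (hv : v ∈ I) (hv' : v' ∈ I) :
    G.neighborSet v ⊆ G.neighborSet v' ∨ G.neighborSet v' ⊆ G.neighborSet v := by
  obtain ⟨w, T, -, -, hw⟩ := hthr
  have key : ∀ v (hv : v ∈ I) v' (hv' : v' ∈ I), w ⟨v, Or.inl hv⟩ ≤ w ⟨v', Or.inl hv'⟩ →
      G.neighborSet v ⊆ G.neighborSet v' := by
    intro v hv v' hv' hle x hx
    have hxI : x ∈ closedNbhd G I := Or.inr ⟨v, hv, hx⟩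
    have hne : x ≠ v' := by
      rintro rfl
      exact hI v hv x hv' hx
    have h1 := (hw ⟨v, Or.inl hv⟩ ⟨x, hxI⟩
      (fun heq => G.ne_of_adj hx (congrArg Subtype.val heq))).1 hx
    exact (hw ⟨v', Or.inl hv'⟩ ⟨x, hxI⟩ (fun heq => hne (congrArg Subtype.val heq).symm)).2
      (by linarith)
  exact (le_total (w ⟨v, Or.inl hv⟩) (w ⟨v', Or.inl hv'⟩)).imp (key v hv v' hv') (key v' hv' v hv)

/-- An independent set with nested neighborhoods whose union is a clique induces, together with
its neighborhood, a threshold graph. -/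
theorem isThresholdGraph_induce_closedNbhd [Finite V] {J : Set V}
    (hJ : ∀ x ∈ J, ∀ y ∈ J, ¬ G.Adj x y) (hclique : G.IsClique (openNbhd G J))
    (hnested : ∀ v ∈ J, ∀ v' ∈ J,
      G.neighborSet v ⊆ G.neighborSet v' ∨ G.neighborSet v' ⊆ G.neighborSet v) :
    IsThresholdGraph (G.induce (closedNbhd G J)) := by
  classical
  let d : V → ℕ := fun v => (G.neighborSet v).ncard
  let M : V → ℕ := fun x => sInf (d '' {v | v ∈ J ∧ G.Adj v x})
  let N := Nat.card V
  have hd : ∀ v, d v ≤ N := fun v => Set.ncard_le_card _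
  have hdsub : ∀ v ∈ J, ∀ v' ∈ J, d v ≤ d v' → G.neighborSet v ⊆ G.neighborSet v' := by
    intro v hv v' hv' hle
    rcases hnested v hv v' hv' with hsub | hsub
    · exact hsub
    · exact (Set.eq_of_subset_of_ncard_le hsub hle).ge
  have hMmem : ∀ x ∈ closedNbhd G J, x ∉ J → ∃ v ∈ J, G.Adj v x ∧ d v = M x := by
    intro x hx hxJ
    obtain ⟨v, hv, hvx⟩ := hx.resolve_left hxJ
    obtain ⟨v', ⟨hv', hvx'⟩, hdv⟩ :=
      Nat.sInf_mem (s := d '' {v | v ∈ J ∧ G.Adj v x}) ⟨d v, v, ⟨hv, hvx⟩, rfl⟩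
    exact ⟨v', hv', hvx', hdv⟩
  have hMN : ∀ x ∈ closedNbhd G J, x ∉ J → M x ≤ N := by
    intro x hx hxJ
    obtain ⟨v, -, -, hv⟩ := hMmem x hx hxJ
    exact hv ▸ hd v
  have hmixed : ∀ v ∈ J, ∀ x ∈ closedNbhd G J, x ∉ J → (G.Adj v x ↔ M x ≤ d v) := by
    intro v hv x hx hxJ
    refine ⟨fun hvx => Nat.sInf_le ⟨v, ⟨hv, hvx⟩, rfl⟩, fun hle => ?_⟩
    obtain ⟨v', hv', hvx', hdv⟩ := hMmem x hx hxJ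
    exact hdsub v' hv' v hv (by omega) hvx'
  let f : V → ℕ := fun x => if x ∈ J then d x + 1 else 2 * N + 2 - M x
  have hfJ : ∀ x ∈ J, f x = d x + 1 := fun x hx => if_pos hx
  have hfK : ∀ x, x ∉ J → f x = 2 * N + 2 - M x := fun x hx => if_neg hx
  have hf : ∀ x ∈ closedNbhd G J, ∀ y ∈ closedNbhd G J, x ≠ y →
      (G.Adj x y ↔ 2 * N + 3 ≤ f x + f y) := by
    intro x hx y hy hxy
    by_cases hxJ : x ∈ J <;> by_cases hyJ : y ∈ J
    · rw [hfJ x hxJ, hfJ y hyJ]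
      have := hd x
      have := hd y
      exact iff_of_false (hJ x hxJ y hyJ) (by omega)
    · rw [hfJ x hxJ, hfK y hyJ, hmixed x hxJ y hy hyJ]
      have := hMN y hy hyJ
      omega
    · rw [hfJ y hyJ, hfK x hxJ, G.adj_comm, hmixed y hyJ x hx hxJ]
      have := hMN x hx hxJ
      omega
    · rw [hfK x hxJ, hfK y hyJ]
      have := hMN x hx hxJ
      have := hMN y hy hyJ
      refine iff_of_true (hclique ⟨hx, hxJ⟩ ⟨hy, hyJ⟩ hxy) ?_
      omega
  refine ⟨fun x => f x, 2 * N + 3, ?_, by positivity, ?_⟩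
  · rintro ⟨x, hx⟩
    have : 0 < f x := by
      by_cases hxJ : x ∈ J
      · rw [hfJ x hxJ]
        omega
      · rw [hfK x hxJ]
        have := hMN x hx hxJ
        omega
    exact Nat.cast_pos.2 this
  · rintro ⟨x, hx⟩ ⟨y, hy⟩ hxy
    have := hf x hx y hy fun heq => hxy (Subtype.ext heq)
    simp only [SimpleGraph.comap_adj, Function.Embedding.subtype_apply, this]
    exact_mod_cast Iff.rfl

theorem IsUnitIntervalGraph.induce_mono {S T : Set V} (hST : S ⊆ T)
    (h : IsUnitIntervalGraph (G.induce T)) : IsUnitIntervalGraph (G.induce S) := by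
  obtain ⟨l, hl⟩ := h
  exact ⟨fun x => l ⟨x, hST x.2⟩, fun u v huv => hl ⟨u, hST u.2⟩ ⟨v, hST v.2⟩
    fun heq => huv (Subtype.ext (Subtype.mk.inj heq))⟩

/-- Removing the first vertex of `U` from the numbering and adding it to `I`. -/
theorem IsPTNumbering.move_first (h : IsPTNumbering G I U p m) {u : V} (hu : u ∈ U)
    (hu0 : p u = 0)
    (hnbr : openNbhd G (insert u I) ⊆ G.neighborSet u ∩ U) :
    IsPTNumbering G (insert u I) (U \ {u}) (fun x => p x - 1) (m - 1) := by
  have hpos : ∀ x ∈ U \ {u}, 0 < p x := by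
    rintro x ⟨hx, hxu⟩
    exact Nat.pos_of_ne_zero fun hx0 => hxu (h.bijOn.injOn hx hu (hx0.trans hu0.symm))
  refine ⟨⟨?_, ?_, ?_⟩, ?_, ?_, ?_⟩
  · intro x hx
    have h1 := hpos x hx
    have h2 := h.bijOn.mapsTo hx.1
    simp only [Set.mem_Iio] at h2 ⊢
    omega
  · intro x hx y hy hxy
    have h1 := hpos x hx
    have h2 := hpos y hy
    simp only at hxy
    exact h.bijOn.injOn hx.1 hy.1 (by omega)
  · intro n hn
    simp only [Set.mem_Iio] at hn
    obtain ⟨x, hx, hxn⟩ := h.bijOn.surjOn (show n + 1 ∈ Set.Iio m from by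
      simp only [Set.mem_Iio]
      omega)
    refine ⟨x, ⟨hx, ?_⟩, ?_⟩
    · rintro rfl
      omega
    · simp only
      omega
  · intro x hx y hy z hz hxy hyz hxz
    exact h.umbrella x hx.1 y hy.1 z hz.1 (by omega) (by omega) hxz
  · intro v hv x hx y hy z hz hvx hvz hxy hyz
    have h1 := hpos x hx
    have h2 := hpos y hy
    have h3 := hpos z hz
    rcases hv with rfl | hv
    · exact h.adj_of_le_of_le hu hz.1 hu hy.1 hvz le_rfl (by omega) (by omega) (by omega)
        (fun heq => hy.2 heq.symm)
    · exact h.consecutive v hv x hx.1 y hy.1 z hz.1 hvx hvz (by omega) (by omega)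
  · intro w hw hw0 t ht
    have h1 := hpos w hw
    obtain ⟨hut, htU⟩ := hnbr ht
    have h2 := hpos t ⟨htU, fun heq => ht.2 (Or.inl heq)⟩
    by_cases htw : t = w
    · exact Or.inl htw
    · exact Or.inr (h.adj_of_le_of_le hu htU hw.1 htU hut (by omega) (by omega) (by omega) le_rfl
        (Ne.symm htw))

/-- In a canonical partition, every maximal clique contained in `U` reaches beyond the
neighborhood of `I`. -/
theorem IsCanonicalPTPartition.exists_lt [Finite V] (hcan : IsCanonicalPTPartition G I U)
    (h : IsPTNumbering G I U p m) {A : Set V} (hA : IsMaximalClique G A) (hAU : A ⊆ U)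
    {v x : V} (hv : v ∈ I) (hx : x ∈ U) (hvx : G.Adj v x) : ∃ a ∈ A, p x < p a := by
  obtain ⟨⟨hunion, hdisj, hI, hunit, hthr, -⟩, hmax⟩ := hcan
  by_contra! hAx
  have hmem : ∀ t, t ∉ I → t ∈ U := fun t ht => by
    have : t ∈ I ∪ U := hunion ▸ Set.mem_univ t
    exact this.resolve_left ht
  have hnotI : ∀ t ∈ U, t ∉ I := fun t ht htI => Set.disjoint_left.1 hdisj htI ht
  obtain ⟨u, hu, hu0⟩ := h.bijOn.surjOn (show 0 ∈ Set.Iio m from by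
    have := h.bijOn.mapsTo hx
    simp only [Set.mem_Iio] at this ⊢
    omega)
  -- the vertices up to a neighbor `y` of `u` form a clique
  have hA_eq : ∀ y ∈ U, p x ≤ p y → y ∈ insert u (G.neighborSet u) →
      A = {z | z ∈ U ∧ p z ≤ p y} := by
    intro y hy hxy huy
    refine hA.2 _ ?_ fun a ha => ⟨hAU ha, (hAx a ha).trans hxy⟩
    rintro z ⟨hz, hzy⟩ z' ⟨hz', hzy'⟩ hne
    rcases huy with rfl | huy
    · exact absurd (h.bijOn.injOn hz hz' (by omega)) hne
    · exact h.adj_of_le_of_le hu hy hz hz' huy (by omega) hzy (by omega) hzy' hne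
  have hAx_eq := hA_eq x hx le_rfl (h.first u hu hu0 ⟨Or.inr ⟨v, hv, hvx⟩, hnotI x hx⟩)
  have huA : ∀ y ∈ U, G.Adj u y → y ∈ A := by
    intro y hy huy
    rcases le_total (p y) (p x) with hle | hle
    · rw [hAx_eq]
      exact ⟨hy, hle⟩
    · rw [hA_eq y hy hle (Or.inr huy)]
      exact ⟨hy, le_rfl⟩
  have hfull : ∀ v' ∈ I, G.Adj v' u → ¬ G.Adj v' x := by
    intro v' hv' hvu' hvx'
    refine hnotI v' (hAU ?_) hv'
    refine hA.mem_of_forall_adj fun a ha _ => ?_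
    exact h.consecutive v' hv' u hu a (hAU ha) x hx hvu' hvx' (by omega) (hAx a ha)
  have huI : ∀ v' ∈ I, ¬ G.Adj v' u := by
    intro v' hv' hvu'
    rcases nested_of_isThresholdGraph hI hthr hv hv' with hsub | hsub
    · exact hfull v' hv' hvu' (hsub hvx)
    · exact hfull v hv (hsub hvu') hvx
  have hsubu : ∀ v' ∈ I, G.neighborSet v' ⊆ G.neighborSet u := by
    intro v' hv' t ht
    have htI : t ∉ I := fun htI => hI v' hv' t htI ht
    rcases h.first u hu hu0 ⟨Or.inr ⟨v', hv', ht⟩, htI⟩ with rfl | hut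
    · exact absurd ht (huI v' hv')
    · exact hut
  have hnbr : openNbhd G (insert u I) ⊆ G.neighborSet u ∩ U := by
    rintro t ⟨ht, htI⟩
    refine ⟨?_, hmem t fun h' => htI (Or.inr h')⟩
    obtain ⟨s, rfl | hs, hst⟩ := ht.resolve_left htI
    · exact hst
    · exact hsubu s hs hst
  have hI' : ∀ y ∈ insert u I, ∀ z ∈ insert u I, ¬ G.Adj y z := by
    rintro y (rfl | hy) z (rfl | hz) hyz
    · exact G.irrefl hyz
    · exact huI z hz hyz.symm
    · exact huI y hy hyz
    · exact hI y hy z hz hyz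
  refine hmax u hu ((h.move_first hu hu0 hnbr).isPairedThresholdPartition ?_ ?_ hI'
    (hunit.induce_mono Set.sdiff_subset) (isThresholdGraph_induce_closedNbhd hI' ?_ ?_))
  · refine Set.eq_univ_of_forall fun t => ?_
    by_cases htu : t = u
    · exact Or.inl (Or.inl htu)
    by_cases htI : t ∈ I
    · exact Or.inl (Or.inr htI)
    · exact Or.inr ⟨hmem t htI, htu⟩
  · rw [Set.disjoint_left]
    rintro t (rfl | ht) ⟨htU, htu⟩
    · exact htu rfl
    · exact hnotI t htU ht
  · exact hA.1.subset fun t ht => huA t (hnbr ht).2 (hnbr ht).1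
  · rintro y (rfl | hy) z (rfl | hz)
    · exact Or.inl le_rfl
    · exact Or.inr (hsubu z hz)
    · exact Or.inl (hsubu y hy)
    · exact nested_of_isThresholdGraph hI hthr hy hz

/-- A clique of a clique path separating two maximal cliques contained in `U` is disjoint
from `I`. -/
theorem IsCanonicalPTPartition.inter_eq_empty_of_separates [Finite V] [Nonempty V]
    (hcan : IsCanonicalPTPartition G I U) (h : IsPTNumbering G I U p m)
    (hadj : ∀ x ∈ U, ∀ y ∈ U, p y = p x + 1 → G.Adj x y)
    {ℓ : ℕ} {C : Fin ℓ → Set V} (hC : IsCliquePath G C) {i j k : Fin ℓ}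
    (hi : C i ⊆ U) (hk : C k ⊆ U) (hik : leastNumber p (C i) ≤ leastNumber p (C k))
    (hsep : ¬ (i < j ↔ k < j)) : C j ∩ I = ∅ := by
  by_contra hne
  obtain ⟨v, hvj, hv⟩ := Set.nonempty_iff_ne_empty.2 hne
  obtain ⟨a, ha, b, hb, hmina, hmema, halla⟩ := h.exists_endpoints (hC.2.1 i) hi
  obtain ⟨c, hc, d, hd, hminc, hmemc, hallc⟩ := h.exists_endpoints (hC.2.1 k) hk
  have hbd : p b ≤ p d := by
    by_contra hle
    have heq := (hC.2.1 k).2 (C i) (hC.2.1 i).1 fun x hx => halla x (hk hx)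
      (by have := hmemc x hx; omega) (by have := hmemc x hx; omega)
    rw [hC.1 heq] at hsep
    exact hsep Iff.rfl
  have havoid := mt (h.lt_iff_lt_of_avoids hadj hC (k := j) (hi hb) (hk hd) hbd hb hd) hsep
  push Not at havoid
  obtain ⟨x, hx, hbx, -, hxj⟩ := havoid
  have hvx : v ≠ x := by
    rintro rfl
    exact Set.disjoint_left.1 hcan.1.2.1 hv hx
  obtain ⟨y, hy, hxy⟩ := hcan.exists_lt h (hC.2.1 i) hi hv hx ((hC.2.1 j).1 hvj hxj hvx)
  have := hmema y hy
  omega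

end

/-- In every clique path of a connected paired threshold graph
with canonical partition `I ⊎ U`, the maximal cliques disjoint from `I` occupy
consecutive positions, and any two clique paths order these cliques
identically or exactly reversed. -/
theorem clique_path_cliques_disjoint_from_I {V : Type*} [Fintype V]
    (G : SimpleGraph V) (hconn : G.Connected) (hG : IsPairedThresholdGraph G)
    (I U : Set V) (hcan : IsCanonicalPTPartition G I U) :
    (∀ (ℓ : ℕ) (C : Fin ℓ → Set V), IsCliquePath G C →
      ∀ i j k : Fin ℓ, i ≤ j → j ≤ k → C i ∩ I = ∅ → C k ∩ I = ∅ → C j ∩ I = ∅) ∧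
    (∀ (ℓ ℓ' : ℕ) (C : Fin ℓ → Set V) (D : Fin ℓ' → Set V),
      IsCliquePath G C → IsCliquePath G D →
      ((∀ (i j : Fin ℓ) (i' j' : Fin ℓ'), i < j → C i ∩ I = ∅ → C j ∩ I = ∅ →
          D i' = C i → D j' = C j → i' < j') ∨
       (∀ (i j : Fin ℓ) (i' j' : Fin ℓ'), i < j → C i ∩ I = ∅ → C j ∩ I = ∅ →
          D i' = C i → D j' = C j → j' < i'))) := by
  obtain ⟨p, m, h⟩ := hcan.1.exists_numbering
  have : Nonempty V := hconn.nonempty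
  obtain ⟨hunion, hdisj, hI, -⟩ := hcan.1
  have hadj : ∀ x ∈ U, ∀ y ∈ U, p y = p x + 1 → G.Adj x y := fun x hx y hy hxy =>
    h.adj_succ hconn hunion hdisj hI hx hy hxy
  have hsub : ∀ A : Set V, A ∩ I = ∅ → A ⊆ U := by
    intro A hA x hx
    have hxI : x ∈ I ∪ U := hunion ▸ Set.mem_univ x
    exact hxI.resolve_left fun hxI => (Set.eq_empty_iff_forall_notMem.1 hA x) ⟨hx, hxI⟩
  constructor
  · intro ℓ C hC i j k hij hjk hi hk
    rcases hij.eq_or_lt with rfl | hij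
    · exact hi
    rcases hjk.eq_or_lt with rfl | hjk
    · exact hk
    rcases le_total (leastNumber p (C i)) (leastNumber p (C k)) with hle | hle
    · exact hcan.inter_eq_empty_of_separates h hadj hC (hsub _ hi) (hsub _ hk) hle (by omega)
    · exact hcan.inter_eq_empty_of_separates h hadj hC (hsub _ hk) (hsub _ hi) hle (by omega)
  · intro ℓ ℓ' C D hC hD
    rcases h.strictMonoOn_or_strictAntiOn hadj hC with hmC | hmC <;>
      rcases h.strictMonoOn_or_strictAntiOn hadj hD with hmD | hmD <;>
      [left; right; right; left] <;>
      intro i j i' j' hij hi hj hi' hj' <;>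
      have hlt := hmC (hsub _ hi) (hsub _ hj) hij <;>
      have hi'U : D i' ⊆ U := hi' ▸ hsub _ hi <;>
      have hj'U : D j' ⊆ U := hj' ▸ hsub _ hj <;>
      simp only [← hi', ← hj'] at hlt
    · exact (hmD.lt_iff_lt hi'U hj'U).1 hlt
    · exact (hmD.lt_iff_gt hi'U hj'U).1 hlt
    · exact (hmD.lt_iff_lt hj'U hi'U).1 hlt
    · exact (hmD.lt_iff_gt hj'U hi'U).1 hlt
end

section
/- For every positive integer k, there exists a paired threshold graph G such that in every interval model of G there are k nested intervals, i.e., there are vertices x₁, …, x_k whose assigned intervals [l(x₁), r(x₁)], …, [l(x_k), r(x_k)] satisfy l(x_k) < l(x_{k−1}) < … < l(x₁) ≤ r(x₁) < r(x₂) < … < r(x_k). -/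
/-- The graph on the weights `1, …, 4 * m + 1` with sum threshold `2 * m + 2` and difference
threshold `2 * m`; the vertex `p` has weight `p + 1`. -/
def consecutiveWeightGraph (m : ℕ) : SimpleGraph (Fin (4 * m + 1)) where
  Adj p q := p ≠ q ∧ 2 * m ≤ (p : ℕ) + q ∧ (p : ℕ) ≤ q + 2 * m ∧ (q : ℕ) ≤ p + 2 * m
  symm := ⟨fun p q h => ⟨h.1.symm, by omega, h.2.2.2, h.2.2.1⟩⟩
  loopless := ⟨fun _ h => h.1 rfl⟩

theorem consecutiveWeightGraph_isPairedThresholdGraph (m : ℕ) (hm : 0 < m) :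
    IsPairedThresholdGraph (consecutiveWeightGraph m) := by
  have hm' : (0 : ℝ) < m := by exact_mod_cast hm
  refine ⟨fun p => (p : ℕ) + 1, 2 * m + 2, 2 * m, fun p => by positivity, by positivity,
    by positivity, fun p q hpq => ?_⟩
  simp only [consecutiveWeightGraph, ne_eq, hpq, not_false_eq_true, true_and]
  rw [abs_le, ← Nat.cast_le (α := ℝ), ← Nat.cast_le (α := ℝ) (m := (p : ℕ)),
    ← Nat.cast_le (α := ℝ) (m := (q : ℕ))]
  push_cast
  constructor
  · rintro ⟨h₁, h₂, h₃⟩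
    exact ⟨by linarith, by linarith, by linarith⟩
  · rintro ⟨h₁, h₂, h₃⟩
    exact ⟨by linarith, by linarith, by linarith⟩

/-- Let `c`, `v`, `y` be families of intervals such that `c i` meets `v j`, and likewise `y j`,
exactly when `j ≤ i`, while the `y i` all meet the fixed interval `y o` and no `v i` meets any
`y j`. Then `c i` is nested in `c j` for `i < j`, provided `v i` and `v j` lie to the left
of `y o`. -/
theorem nested_of_left {V ι : Type*} [LinearOrder ι] {l r : V → ℝ} (hlr : ∀ u, l u ≤ r u)
    {c v y : ι → V} {o : ι}
    (hcv : ∀ i j, (l (c i) ≤ r (v j) ∧ l (v j) ≤ r (c i)) ↔ j ≤ i)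
    (hcy : ∀ i j, (l (c i) ≤ r (y j) ∧ l (y j) ≤ r (c i)) ↔ j ≤ i)
    (hyy : ∀ i, l (y i) ≤ r (y o) ∧ l (y o) ≤ r (y i))
    (hvy : ∀ i j, ¬(l (v i) ≤ r (y j) ∧ l (y j) ≤ r (v i)))
    {i j : ι} (hij : i < j) (hi : r (v i) < l (y o)) (hj : r (v j) < l (y o)) :
    l (c j) < l (c i) ∧ r (c i) < r (c j) := by
  have left_of_all : ∀ a b, r (v a) < l (y o) → r (v a) < l (y b) := by
    intro a b ha
    by_contra! h
    exact hvy a b ⟨by linarith [hlr (v a), hyy b], h⟩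
  have hl : r (v j) < l (c i) := by
    by_contra! h
    refine hij.not_ge ((hcv i j).1 ⟨h, ?_⟩)
    linarith [hlr (v j), left_of_all j i hj, ((hcy i i).2 le_rfl).2]
  have hr : r (c i) < l (y j) := by
    by_contra! h
    refine hij.not_ge ((hcy i j).1 ⟨?_, h⟩)
    linarith [hlr (y j), left_of_all i j hi, ((hcv i i).2 le_rfl).1]
  exact ⟨((hcv j j).2 le_rfl).1.trans_lt hl, hr.trans_le ((hcy j j).2 le_rfl).2⟩

/-- A predicate on `Fin (2 * k)` is constant on the range of some strictly monotone map
from `Fin k`. -/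
theorem exists_strictMono_forall_or_forall_not (k : ℕ) (P : Fin (2 * k) → Prop) :
    ∃ f : Fin k → Fin (2 * k), StrictMono f ∧ ((∀ i, P (f i)) ∨ ∀ i, ¬P (f i)) := by
  classical
  have hcard := Finset.card_filter_add_card_filter_not (s := Finset.univ) P
  rw [Finset.card_univ, Fintype.card_fin] at hcard
  obtain h | h : k ≤ (Finset.univ.filter P).card ∨ k ≤ (Finset.univ.filter (¬P ·)).card := by
    omega
  · exact ⟨_, (Finset.orderEmbOfCardLe _ h).strictMono,
      .inl fun i => (Finset.mem_filter.1 (Finset.orderEmbOfCardLe_mem _ h i)).2⟩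
  · exact ⟨_, (Finset.orderEmbOfCardLe _ h).strictMono,
      .inr fun i => (Finset.mem_filter.1 (Finset.orderEmbOfCardLe_mem _ h i)).2⟩

/-- For every `k ≥ 1` there is a paired threshold graph such
that every interval model of it contains `k` nested intervals. -/
theorem exists_paired_threshold_with_nested_intervals (k : ℕ) (hk : 0 < k) :
    ∃ (n : ℕ) (G : SimpleGraph (Fin n)), IsPairedThresholdGraph G ∧
      ∀ l r : Fin n → ℝ, (∀ v, l v ≤ r v) →
        (∀ u v, u ≠ v →
          (G.Adj u v ↔ (Set.Icc (l u) (r u) ∩ Set.Icc (l v) (r v)).Nonempty)) →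
        ∃ x : Fin k → Fin n,
          ∀ i j : Fin k, i < j → l (x j) < l (x i) ∧ r (x i) < r (x j) := by
  obtain ⟨m, hm⟩ : ∃ m, m = 2 * k := ⟨_, rfl⟩
  refine ⟨4 * m + 1, consecutiveWeightGraph m,
    consecutiveWeightGraph_isPairedThresholdGraph m (by omega), fun l r hlr hadj => ?_⟩
  have meet : ∀ p q : Fin (4 * m + 1), p ≠ q → ((l p ≤ r q ∧ l q ≤ r p) ↔
      2 * m ≤ (p : ℕ) + q ∧ (p : ℕ) ≤ q + 2 * m ∧ (q : ℕ) ≤ p + 2 * m) := by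
    intro p q hpq
    have h := hadj p q hpq
    rw [Set.Icc_inter_Icc, Set.nonempty_Icc, sup_le_iff, le_inf_iff, le_inf_iff] at h
    simp only [consecutiveWeightGraph, ne_eq, hpq, not_false_eq_true, true_and] at h
    rw [h]
    exact ⟨fun h => ⟨⟨hlr p, h.1⟩, h.2, hlr q⟩, fun h => ⟨h.1.2, h.2.1⟩⟩
  let c : Fin (2 * k) → Fin (4 * m + 1) := fun i => ⟨m + 1 + i, by omega⟩
  let v : Fin (2 * k) → Fin (4 * m + 1) := fun i => ⟨m - 1 - i, by omega⟩
  let y : Fin (2 * k) → Fin (4 * m + 1) := fun i => ⟨3 * m + 1 + i, by omega⟩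
  let o : Fin (2 * k) := ⟨0, by omega⟩
  have hcv : ∀ i j, (l (c i) ≤ r (v j) ∧ l (v j) ≤ r (c i)) ↔ j ≤ i := by
    intro i j
    rw [meet _ _ (by simp only [c, v, ne_eq, Fin.mk.injEq]; omega)]
    simp only [c, v, Fin.le_def]
    omega
  have hcy : ∀ i j, (l (c i) ≤ r (y j) ∧ l (y j) ≤ r (c i)) ↔ j ≤ i := by
    intro i j
    rw [meet _ _ (by simp only [c, y, ne_eq, Fin.mk.injEq]; omega)]
    simp only [c, y, Fin.le_def]
    omega
  have hyy : ∀ i, l (y i) ≤ r (y o) ∧ l (y o) ≤ r (y i) := by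
    intro i
    obtain rfl | hi := eq_or_ne i o
    · exact ⟨hlr _, hlr _⟩
    rw [meet _ _ (by simpa [y, Fin.ext_iff] using hi)]
    simp only [y, o]
    omega
  have hvy : ∀ i j, ¬(l (v i) ≤ r (y j) ∧ l (y j) ≤ r (v i)) := by
    intro i j
    rw [meet _ _ (by simp only [v, y, ne_eq, Fin.mk.injEq]; omega)]
    simp only [v, y]
    omega
  obtain ⟨f, hf, hleft | hright⟩ :=
    exists_strictMono_forall_or_forall_not k fun i => r (v i) < l (y o)
  · exact ⟨c ∘ f, fun i j hij =>
      nested_of_left hlr hcv hcy hyy hvy (hf hij) (hleft i) (hleft j)⟩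
  · have hright' : ∀ i, r (y o) < l (v (f i)) := fun i =>
      lt_of_not_ge fun h => hvy (f i) o ⟨h, not_lt.1 (hright i)⟩
    refine ⟨c ∘ f, fun i j hij => ?_⟩
    have h := nested_of_left (l := fun u => -r u) (r := fun u => -l u) (c := c) (v := v) (y := y)
      (o := o) (fun u => neg_le_neg (hlr u))
      (fun i j => by simpa [and_comm] using hcv i j) (fun i j => by simpa [and_comm] using hcy i j)
      (fun i => by simpa [and_comm] using hyy i) (fun i j => by simpa [and_comm] using hvy i j)
      (hf hij) (neg_lt_neg (hright' i)) (neg_lt_neg (hright' j))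
    exact ⟨neg_lt_neg_iff.1 h.2, neg_lt_neg_iff.1 h.1⟩
end

section
/- Fix a positive integer k, and let G be the graph with vertex set {v₁, …, v_k} ∪ {u₁, …, u_{4k}} (all 5k vertices distinct) in which u_i and u_j are adjacent if and only if 0 < |i − j| ≤ 2k, v_i and u_j are adjacent if and only if 1 ≤ i ≤ j ≤ k, and no two vertices v_i, v_j are adjacent. Then (a) G is a paired threshold graph; and (b) in every interval model of G, for all 1 ≤ i < j ≤ k the interval assigned to u_i is properly nested inside the interval assigned to u_j, i.e., l(u_j) < l(u_i) ≤ r(u_i) < r(u_j). -/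
/-- The graph on vertices `v₁, …, v_k` (`Sum.inl`) and `u₁, …, u_{4k}`
(`Sum.inr`, zero-indexed): `uᵢ ~ uⱼ` iff `0 < |i - j| ≤ 2k`; `vᵢ ~ uⱼ` iff
`i ≤ j < k` (zero-indexed, i.e. `1 ≤ i+1 ≤ j+1 ≤ k` one-indexed); no two `v`'s
are adjacent. -/
def nestedGadget (k : ℕ) : SimpleGraph (Fin k ⊕ Fin (4 * k)) :=
  SimpleGraph.fromRel fun x y =>
    match x, y with
    | Sum.inr i, Sum.inr j => |(i : ℤ) - (j : ℤ)| ≤ 2 * k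
    | Sum.inl i, Sum.inr j => (i : ℕ) ≤ (j : ℕ) ∧ (j : ℕ) < k
    | _, _ => False

lemma nestedGadget_adj_inr_inr {k : ℕ} (i j : Fin (4 * k)) :
    (nestedGadget k).Adj (Sum.inr i) (Sum.inr j) ↔
      (i : ℕ) ≠ j ∧ (i : ℕ) ≤ j + 2 * k ∧ (j : ℕ) ≤ i + 2 * k := by
  simp only [nestedGadget, SimpleGraph.fromRel_adj, ne_eq, Sum.inr.injEq, Fin.ext_iff, abs_le]
  omega

lemma nestedGadget_adj_inl_inr {k : ℕ} (i : Fin k) (j : Fin (4 * k)) :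
    (nestedGadget k).Adj (Sum.inl i) (Sum.inr j) ↔ (i : ℕ) ≤ j ∧ (j : ℕ) < k := by
  simp [nestedGadget]

lemma nestedGadget_adj_inl_inl {k : ℕ} (i j : Fin k) :
    ¬ (nestedGadget k).Adj (Sum.inl i) (Sum.inl j) := by
  simp [nestedGadget]

/-- Integer weights realizing `nestedGadget k` as a paired threshold graph with
thresholds `6 * k` and `4 * k`. -/
def nestedGadgetWeight (k : ℕ) : Fin k ⊕ Fin (4 * k) → ℤ
  | Sum.inl i => 2 * k - i
  | Sum.inr j => 4 * k + j + (if (j : ℕ) < k then 0 else 2 * k) +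
      (if (j : ℕ) < 3 * k then 0 else 2 * k)

lemma nestedGadgetWeight_pos {k : ℕ} (x : Fin k ⊕ Fin (4 * k)) : 0 < nestedGadgetWeight k x := by
  rcases x with i | j
  · have := i.isLt
    simp only [nestedGadgetWeight]
    omega
  · have := j.isLt
    simp only [nestedGadgetWeight]
    split_ifs <;> omega

lemma nestedGadget_adj_iff_weight {k : ℕ} {x y : Fin k ⊕ Fin (4 * k)} (hxy : x ≠ y) :
    (nestedGadget k).Adj x y ↔
      6 * (k : ℤ) ≤ nestedGadgetWeight k x + nestedGadgetWeight k y ∧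
        |nestedGadgetWeight k x - nestedGadgetWeight k y| ≤ 4 * (k : ℤ) := by
  rcases x with i | i <;> rcases y with j | j
  · have := i.isLt
    have := j.isLt
    have hij : (i : ℕ) ≠ j := fun h => hxy (congrArg Sum.inl (Fin.ext h))
    simp only [nestedGadget_adj_inl_inl, nestedGadgetWeight, abs_le, false_iff]
    omega
  · have := i.isLt
    have := j.isLt
    simp only [nestedGadget_adj_inl_inr, nestedGadgetWeight, abs_le]
    split_ifs <;> omega
  · have := i.isLt
    have := j.isLt
    simp only [(nestedGadget k).adj_comm (Sum.inr i), nestedGadget_adj_inl_inr,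
      nestedGadgetWeight, abs_le]
    split_ifs <;> omega
  · have := i.isLt
    have := j.isLt
    have hij : (i : ℕ) ≠ j := fun h => hxy (congrArg Sum.inr (Fin.ext h))
    simp only [nestedGadget_adj_inr_inr, nestedGadgetWeight, abs_le]
    split_ifs <;> omega

theorem nestedGadget_isPairedThresholdGraph {k : ℕ} (hk : 0 < k) :
    IsPairedThresholdGraph (nestedGadget k) := by
  refine ⟨fun x => nestedGadgetWeight k x, 6 * k, 4 * k, fun x => ?_, by positivity,
    by positivity, fun x y hxy => ?_⟩
  · exact Int.cast_pos.2 (nestedGadgetWeight_pos x)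
  · rw [nestedGadget_adj_iff_weight hxy]
    beta_reduce
    norm_cast

lemma Icc_inter_Icc_nonempty_iff {α : Type*} [LinearOrder α] {a b c d : α}
    (hab : a ≤ b) (hcd : c ≤ d) :
    (Set.Icc a b ∩ Set.Icc c d).Nonempty ↔ a ≤ d ∧ c ≤ b := by
  rw [Set.Icc_inter_Icc, Set.nonempty_Icc, sup_le_iff, le_inf_iff, le_inf_iff]
  tauto

/-- The gadget graph is a paired threshold graph, and in every
interval model of it the interval of `uᵢ` is properly nested in that of `uⱼ`
whenever `i < j < k`. -/
theorem nested_gadget_properties (k : ℕ) (hk : 0 < k) :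
    IsPairedThresholdGraph (nestedGadget k) ∧
    ∀ l r : (Fin k ⊕ Fin (4 * k)) → ℝ, (∀ v, l v ≤ r v) →
      (∀ u v, u ≠ v →
        ((nestedGadget k).Adj u v ↔
          (Set.Icc (l u) (r u) ∩ Set.Icc (l v) (r v)).Nonempty)) →
      ∀ i j : Fin (4 * k), i < j → (j : ℕ) < k →
        l (Sum.inr j) < l (Sum.inr i) ∧ l (Sum.inr i) ≤ r (Sum.inr i) ∧
          r (Sum.inr i) < r (Sum.inr j) := by
  refine ⟨nestedGadget_isPairedThresholdGraph hk, fun l r hlr hadj i j hlt hjk => ?_⟩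
  replace hlt : (i : ℕ) < j := hlt
  have meet : ∀ x y, x ≠ y → ((nestedGadget k).Adj x y ↔ l x ≤ r y ∧ l y ≤ r x) :=
    fun x y hxy => (hadj x y hxy).trans (Icc_inter_Icc_nonempty_iff (hlr x) (hlr y))
  have meet_inr (a b : Fin (4 * k)) (hab : (a : ℕ) ≠ b) :=
    (nestedGadget_adj_inr_inr a b).symm.trans
      (meet (Sum.inr a) (Sum.inr b) fun h => hab (congrArg Fin.val (Sum.inr.inj h)))
  have meet_inl (a : Fin k) (b : Fin (4 * k)) :=
    (nestedGadget_adj_inl_inr a b).symm.trans (meet (Sum.inl a) (Sum.inr b) Sum.inl_ne_inr)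
  -- `v` and `d` both meet `u_j` but not `u_i`; the vertices `e` and `f` rule out
  -- that they lie on the same side of `u_i`.
  let v : Fin k := ⟨j, hjk⟩
  let d : Fin (4 * k) := ⟨j + 2 * k, by omega⟩
  let e : Fin (4 * k) := ⟨i + 2 * k, by omega⟩
  let f : Fin (4 * k) := ⟨4 * k - 1, by omega⟩
  have hvi := mt (meet_inl v i).2 (by simp only [v]; omega)
  have hvj := (meet_inl v j).1 (by simp only [v]; omega)
  have hvd := mt (meet_inl v d).2 (by simp only [v, d]; omega)
  have hve := mt (meet_inl v e).2 (by simp only [v, e]; omega)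
  have hij := (meet_inr i j (by omega)).1 (by omega)
  have hdi := mt (meet_inr d i (by simp only [d]; omega)).2 (by simp only [d]; omega)
  have hdj := (meet_inr d j (by simp only [d]; omega)).1 (by simp only [d]; omega)
  have hei := (meet_inr e i (by simp only [e]; omega)).1 (by simp only [e]; omega)
  have hed := (meet_inr e d (by simp only [e, d]; omega)).1 (by simp only [e, d]; omega)
  have hfj := mt (meet_inr f j (by simp only [f]; omega)).2 (by simp only [f]; omega)
  have hfd := (meet_inr f d (by simp only [f, d]; omega)).1 (by simp only [f, d]; omega)
  have := hlr (Sum.inl v)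
  have := hlr (Sum.inr i)
  have := hlr (Sum.inr j)
  have := hlr (Sum.inr d)
  have := hlr (Sum.inr e)
  have := hlr (Sum.inr f)
  clear_value v d e f
  clear meet meet_inr meet_inl hadj hlr
  grind
end

section
/- The net graph, i.e., the 6-vertex graph consisting of a triangle {a, b, c} together with three additional vertices a′, b′, c′ where a′ is adjacent only to a, b′ is adjacent only to b, and c′ is adjacent only to c, is not a paired threshold graph. -/
/-- The net graph: a triangle `0, 1, 2` with pendant vertices `3, 4, 5`
attached to `0, 1, 2` respectively. -/
def netGraph : SimpleGraph (Fin 6) :=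
  SimpleGraph.fromRel fun i j =>
    (i = 0 ∧ j = 1) ∨ (i = 0 ∧ j = 2) ∨ (i = 1 ∧ j = 2) ∨
    (i = 0 ∧ j = 3) ∨ (i = 1 ∧ j = 4) ∨ (i = 2 ∧ j = 5)

/-- Weights `a ≤ b ≤ c` of three vertices cannot be extended by weights `a'`, `b'` of two further
vertices such that `a` is joined to `c`, `a'` to `a` and `b'` to `b`, while `a'` is not joined
to `b`, `c` and `b'` is not joined to `a`, `c`. -/
lemma not_paired_threshold_pendants {a b c a' b' Tp Tm : ℝ} (hab : a ≤ b) (hbc : b ≤ c)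
    (hac : Tp ≤ a + c ∧ |a - c| ≤ Tm)
    (haa' : Tp ≤ a + a' ∧ |a - a'| ≤ Tm) (hbb' : Tp ≤ b + b' ∧ |b - b'| ≤ Tm)
    (hba' : ¬(Tp ≤ b + a' ∧ |b - a'| ≤ Tm)) (hca' : ¬(Tp ≤ c + a' ∧ |c - a'| ≤ Tm))
    (hab' : ¬(Tp ≤ a + b' ∧ |a - b'| ≤ Tm)) (hcb' : ¬(Tp ≤ c + b' ∧ |c - b'| ≤ Tm)) :
    False := by
  simp only [abs_le] at *
  have hb'a : b' < a := by
    by_contra! h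
    exact hcb' ⟨by linarith, by linarith, by linarith⟩
  have ha'a : a' < a := by
    by_contra! h
    exact hca' ⟨by linarith, by linarith, by linarith⟩
  have hsum : a + b' < Tp := by
    by_contra! h
    exact hab' ⟨h, by linarith, by linarith⟩
  exact hba' ⟨by linarith, by linarith, by linarith⟩

/-- The net graph is not a paired threshold graph. -/
theorem netGraph_not_paired_threshold : ¬ IsPairedThresholdGraph netGraph := by
  rintro ⟨w, Tp, Tm, -, -, -, h⟩
  have key (a b c a' b' : Fin 6) (hab : w a ≤ w b) (hbc : w b ≤ w c)
      (hadj : netGraph.Adj a c ∧ netGraph.Adj a a' ∧ netGraph.Adj b b')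
      (hnadj : (b ≠ a' ∧ ¬ netGraph.Adj b a') ∧ (c ≠ a' ∧ ¬ netGraph.Adj c a') ∧
        (a ≠ b' ∧ ¬ netGraph.Adj a b') ∧ (c ≠ b' ∧ ¬ netGraph.Adj c b')) : False := by
    obtain ⟨hac, haa', hbb'⟩ := hadj
    obtain ⟨hba', hca', hab', hcb'⟩ := hnadj
    exact not_paired_threshold_pendants hab hbc ((h _ _ hac.ne).1 hac) ((h _ _ haa'.ne).1 haa')
      ((h _ _ hbb'.ne).1 hbb') (mt (h _ _ hba'.1).2 hba'.2) (mt (h _ _ hca'.1).2 hca'.2)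
      (mt (h _ _ hab'.1).2 hab'.2) (mt (h _ _ hcb'.1).2 hcb'.2)
  rcases le_total (w 0) (w 1) with h01 | h01 <;> rcases le_total (w 1) (w 2) with h12 | h12 <;>
    rcases le_total (w 0) (w 2) with h02 | h02
  · exact key 0 1 2 3 4 h01 h12 (by simp [netGraph]) (by simp [netGraph])
  · exact key 0 1 2 3 4 h01 h12 (by simp [netGraph]) (by simp [netGraph])
  · exact key 0 2 1 3 5 h02 h12 (by simp [netGraph]) (by simp [netGraph])
  · exact key 2 0 1 5 3 h02 h01 (by simp [netGraph]) (by simp [netGraph])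
  · exact key 1 0 2 4 3 h01 h02 (by simp [netGraph]) (by simp [netGraph])
  · exact key 1 2 0 4 5 h12 h02 (by simp [netGraph]) (by simp [netGraph])
  · exact key 2 1 0 5 4 h12 h01 (by simp [netGraph]) (by simp [netGraph])
  · exact key 2 1 0 5 4 h12 h01 (by simp [netGraph]) (by simp [netGraph])
end
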